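/- arXiv:1412.4076 — 2 statements merged into one kernel-verified Lean document; each statement's English description precedes it below -/
import Mathlib

section
/- For the 12-taxon rooted binary trees T_A and T_B (each obtained by joining two disjoint copies of T_a, respectively T_b, under a new root): the maximum over all characters f of (l_f(T_B) − l_f(T_A)) equals 4, and the maximum over all characters f of (l_f(T_A) − l_f(T_B)) equals 2. Consequently gap(T_A,T_B) = 2. -/
namespace MPDist

/-- A rooted binary phylogenetic tree: leaves are labelled by taxa,
every internal vertex (including the root) has exactly two children. -/
inductive PTree (X : Type) : Type
  | leaf : X → PTree X
  | node : PTree X → PTree X → PTree X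

namespace PTree

/-- The list of leaf labels (taxa) of a tree. -/
def leaves {X : Type} : PTree X → List X
  | .leaf x => [x]
  | .node l r => l.leaves ++ r.leaves

/-- Relabelling of taxa. -/
def map {X Y : Type} (φ : X → Y) : PTree X → PTree Y
  | .leaf x => .leaf (φ x)
  | .node l r => .node (l.map φ) (r.map φ)

end PTree

/-- `T` is a phylogenetic tree on the taxon set `X`:
its leaves are bijectively labelled by the elements of `X`. -/
def IsPhylo {X : Type} (T : PTree X) : Prop :=
  T.leaves.Nodup ∧ ∀ x : X, x ∈ T.leaves

/-- A state-labelled binary tree (an extension assigns a state to every vertex). -/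
inductive ETree (C : Type) : Type
  | leaf : C → ETree C
  | node : C → ETree C → ETree C → ETree C

namespace ETree

/-- The state at the root. -/
def root {C : Type} : ETree C → C
  | .leaf c => c
  | .node c _ _ => c

/-- The number of edges `{u,v}` with different states at the two endpoints
(substitutions/mutations). -/
def changes {C : Type} [DecidableEq C] : ETree C → ℕ
  | .leaf _ => 0
  | .node c l r =>
      ((if l.root = c then 0 else 1) + (if r.root = c then 0 else 1)) +
        (l.changes + r.changes)

end ETree

/-- `g` is an extension of the character `f` to the tree `T`: it has the same
shape as `T`, assigns a state to every vertex, and agrees with `f` on the taxa. -/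
inductive IsExtension {X C : Type} (f : X → C) : PTree X → ETree C → Prop
  | leaf (x : X) : IsExtension f (.leaf x) (.leaf (f x))
  | node {l r : PTree X} {gl gr : ETree C} (c : C) :
      IsExtension f l gl → IsExtension f r gr →
      IsExtension f (.node l r) (.node c gl gr)

/-- The parsimony score `l_f(T)`: the minimum number of mutation edges
over all extensions of `f` to `T`. -/
noncomputable def pscore {X C : Type} [DecidableEq C] (f : X → C) (T : PTree X) : ℕ :=
  sInf { k : ℕ | ∃ g : ETree C, IsExtension f T g ∧ g.changes = k }

/-- The MP distance `d_MP(T1,T2) = max_f |l_f(T1) − l_f(T2)|`, the maximum taken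
over all characters `f` on the taxon set (states drawn from `ℕ`). -/
noncomputable def dMP {X : Type} (T1 T2 : PTree X) : ℕ :=
  sSup { k : ℕ | ∃ f : X → ℕ, k = ((pscore f T1 : ℤ) - (pscore f T2 : ℤ)).natAbs }

/-- `d^i_MP(T1,T2)`: as `dMP`, but over characters using at most `i` states. -/
noncomputable def dMPk {X : Type} (i : ℕ) (T1 T2 : PTree X) : ℕ :=
  sSup { k : ℕ | ∃ f : X → Fin i, k = ((pscore f T1 : ℤ) - (pscore f T2 : ℤ)).natAbs }

/-- `max_f (l_f(T2) − l_f(T1))` over all characters `f`. -/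
noncomputable def maxDiff {X : Type} (T1 T2 : PTree X) : ℤ :=
  sSup { d : ℤ | ∃ f : X → ℕ, d = (pscore f T2 : ℤ) - (pscore f T1 : ℤ) }

/-- `max_f (l_f(T2) − l_f(T1))` over all characters `f` with at most `i` states. -/
noncomputable def maxDiffk {X : Type} (i : ℕ) (T1 T2 : PTree X) : ℤ :=
  sSup { d : ℤ | ∃ f : X → Fin i, d = (pscore f T2 : ℤ) - (pscore f T1 : ℤ) }

/-- `gap(T1,T2) = |max_f(l_f(T2)−l_f(T1)) − max_f(l_f(T1)−l_f(T2))|`. -/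
noncomputable def gap {X : Type} (T1 T2 : PTree X) : ℤ :=
  |maxDiff T1 T2 - maxDiff T2 T1|

/-- `gap` restricted to characters with at most `i` states. -/
noncomputable def gapk {X : Type} (i : ℕ) (T1 T2 : PTree X) : ℤ :=
  |maxDiffk i T1 T2 - maxDiffk i T2 T1|

/-- `s` occurs as a (rooted) subtree of `t`. -/
inductive IsSubtree {X : Type} : PTree X → PTree X → Prop
  | refl (t : PTree X) : IsSubtree t t
  | left {s l r : PTree X} : IsSubtree s l → IsSubtree s (.node l r)
  | right {s l r : PTree X} : IsSubtree s r → IsSubtree s (.node l r)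

/-- Taxa `a`, `b` form a cherry of `T`: they are leaves with a common parent. -/
def IsCherry {X : Type} (T : PTree X) (a b : X) : Prop :=
  IsSubtree (.node (.leaf a) (.leaf b)) T

/-- Relabel a tree on taxa `ℕ` by shifting all labels up by `s` (fresh copies). -/
def shiftT (s : ℕ) (T : PTree ℕ) : PTree ℕ := T.map (fun x => x + s)

/-- `T_a = (((((2,3),4),5),6),1)` on taxa `{1,…,6}` (taxon `j` encoded as `j-1`). -/
def Ta6 : PTree ℕ :=
  .node (.node (.node (.node (.node (.leaf 1) (.leaf 2)) (.leaf 3)) (.leaf 4)) (.leaf 5)) (.leaf 0)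

/-- `T_b = ((((2,6),(3,4)),5),1)` on taxa `{1,…,6}` (taxon `j` encoded as `j-1`). -/
def Tb6 : PTree ℕ :=
  .node (.node (.node (.node (.leaf 1) (.leaf 5)) (.node (.leaf 2) (.leaf 3))) (.leaf 4)) (.leaf 0)

/-- `T_A`: two disjoint copies of `T_a` joined under a new root (12 taxa). -/
def TA12 : PTree ℕ := .node Ta6 (shiftT 6 Ta6)

/-- `T_B`: two disjoint copies of `T_b` joined under a new root (12 taxa). -/
def TB12 : PTree ℕ := .node Tb6 (shiftT 6 Tb6)

/-- `TkA k` is the tree `T^{k+1}_A`: `k+1` disjoint copies of `T_A` arranged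
along a caterpillar backbone (so `TkA 0 = T^1_A = T_A`). -/
def TkA : ℕ → PTree ℕ
  | 0 => TA12
  | k+1 => .node (TkA k) (shiftT (12*(k+1)) TA12)

/-- `TkB k` is the tree `T^{k+1}_B`. -/
def TkB : ℕ → PTree ℕ
  | 0 => TB12
  | k+1 => .node (TkB k) (shiftT (12*(k+1)) TB12)

/-- `T_a = (((5,(6,4)),3),((1,(8,2)),7))` on taxa `{1,…,8}` (taxon `j` encoded as `j-1`). -/
def Ta8 : PTree ℕ :=
  .node (.node (.node (.leaf 4) (.node (.leaf 5) (.leaf 3))) (.leaf 2))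
        (.node (.node (.leaf 0) (.node (.leaf 7) (.leaf 1))) (.leaf 6))

/-- `T_b = (((7,((4,2),6)),3),(8,(1,5)))` on taxa `{1,…,8}` (taxon `j` encoded as `j-1`). -/
def Tb8 : PTree ℕ :=
  .node (.node (.node (.leaf 6) (.node (.node (.leaf 3) (.leaf 1)) (.leaf 5))) (.leaf 2))
        (.node (.leaf 7) (.node (.leaf 0) (.leaf 4)))

/-- `T_A` (2-state construction): two disjoint copies of `T_a` under a new root (16 taxa). -/
def TA16 : PTree ℕ := .node Ta8 (shiftT 8 Ta8)

/-- `T_B` (2-state construction): two disjoint copies of `T_b` under a new root (16 taxa). -/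
def TB16 : PTree ℕ := .node Tb8 (shiftT 8 Tb8)

/-- `T_AA`: two disjoint copies of `T_A` under a new root (32 taxa). -/
def TAA : PTree ℕ := .node TA16 (shiftT 16 TA16)

/-- `T_BB`: two disjoint copies of `T_B` under a new root (32 taxa). -/
def TBB : PTree ℕ := .node TB16 (shiftT 16 TB16)

/-- `TkAA k` is the tree `T^{k+1}_AA` (so `TkAA 0 = T^1_AA = T_AA`). -/
def TkAA : ℕ → PTree ℕ
  | 0 => TAA
  | k+1 => .node (TkAA k) (shiftT (32*(k+1)) TAA)

/-- `TkBB k` is the tree `T^{k+1}_BB`. -/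
def TkBB : ℕ → PTree ℕ
  | 0 => TBB
  | k+1 => .node (TkBB k) (shiftT (32*(k+1)) TBB)


def fitch (f : ℕ → ℕ) : PTree ℕ → Finset ℕ × ℕ
  | .leaf x => ({f x}, 0)
  | .node l r =>
      if (fitch f l).1 ∩ (fitch f r).1 = ∅ then
        ((fitch f l).1 ∪ (fitch f r).1, (fitch f l).2 + (fitch f r).2 + 1)
      else ((fitch f l).1 ∩ (fitch f r).1, (fitch f l).2 + (fitch f r).2)

lemma fitch_lower (f : ℕ → ℕ) (T : PTree ℕ) (g : ETree ℕ) (h : IsExtension f T g) :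
    (fitch f T).2 + (if g.root ∈ (fitch f T).1 then 0 else 1) ≤ g.changes := by
  induction h with
  | leaf x => simp [fitch, ETree.root, ETree.changes]
  | @node l r gl gr c _ _ ihl ihr =>
    have hl : (fitch f l).2 + (if c ∈ (fitch f l).1 then 0 else 1)
        ≤ gl.changes + (if gl.root = c then 0 else 1) := by
      by_cases hc : gl.root = c
      · subst hc; simpa using ihl
      · simp only [hc, if_false]; split_ifs at * <;> omega
    have hr : (fitch f r).2 + (if c ∈ (fitch f r).1 then 0 else 1)
        ≤ gr.changes + (if gr.root = c then 0 else 1) := by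
      by_cases hc : gr.root = c
      · subst hc; simpa using ihr
      · simp only [hc, if_false]; split_ifs at * <;> omega
    have hrt : (ETree.node c gl gr).root = c := rfl
    rw [hrt]
    simp only [ETree.changes, fitch]
    by_cases he : (fitch f l).1 ∩ (fitch f r).1 = ∅
    · have hn : ¬ (c ∈ (fitch f l).1 ∧ c ∈ (fitch f r).1) := by
        rw [← Finset.mem_inter, he]; simp
      simp only [he, if_true, Finset.mem_union]
      by_cases h1 : c ∈ (fitch f l).1 <;> by_cases h2 : c ∈ (fitch f r).1 <;>
        simp only [h1, h2, if_true, if_false, or_true, true_or, or_false, and_self, not_true] at * <;> omega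
    · simp only [he, if_false, Finset.mem_inter]
      by_cases h1 : c ∈ (fitch f l).1 <;> by_cases h2 : c ∈ (fitch f r).1 <;>
        simp only [h1, h2, if_true, if_false, and_true, true_and, and_false, and_self] at * <;> omega

lemma fitch_nonempty (f : ℕ → ℕ) (T : PTree ℕ) : (fitch f T).1.Nonempty := by
  induction T with
  | leaf x => simp [fitch]
  | node l r ihl ihr =>
    simp only [fitch]
    split_ifs with h
    · exact ihl.mono Finset.subset_union_left
    · exact Finset.nonempty_iff_ne_empty.mpr h

lemma fitch_upper (f : ℕ → ℕ) (T : PTree ℕ) : ∀ c ∈ (fitch f T).1,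
    ∃ g, IsExtension f T g ∧ g.root = c ∧ g.changes = (fitch f T).2 := by
  induction T with
  | leaf x =>
    intro c hc
    refine ⟨.leaf (f x), .leaf x, ?_, rfl⟩
    simp only [fitch, Finset.mem_singleton] at hc
    exact hc.symm
  | node l r ihl ihr =>
    intro c hc
    simp only [fitch] at hc ⊢
    by_cases he : (fitch f l).1 ∩ (fitch f r).1 = ∅
    · simp only [he, if_true] at hc ⊢
      have hn : ¬ (c ∈ (fitch f l).1 ∧ c ∈ (fitch f r).1) := by
        rw [← Finset.mem_inter, he]; simp
      rcases Finset.mem_union.mp hc with h | h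
      · obtain ⟨gl, e1, e2, e3⟩ := ihl c h
        obtain ⟨d, hd⟩ := fitch_nonempty f r
        obtain ⟨gr, k1, k2, k3⟩ := ihr d hd
        have : d ≠ c := by rintro rfl; exact hn ⟨h, hd⟩
        refine ⟨.node c gl gr, .node c e1 k1, rfl, ?_⟩
        simp only [ETree.changes, e2, k2, e3, k3, this, if_true, if_false]; omega
      · obtain ⟨gr, k1, k2, k3⟩ := ihr c h
        obtain ⟨d, hd⟩ := fitch_nonempty f l
        obtain ⟨gl, e1, e2, e3⟩ := ihl d hd
        have : d ≠ c := by rintro rfl; exact hn ⟨hd, h⟩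
        refine ⟨.node c gl gr, .node c e1 k1, rfl, ?_⟩
        simp only [ETree.changes, e2, k2, e3, k3, this, if_true, if_false]; omega
    · simp only [he, if_false] at hc ⊢
      obtain ⟨h1, h2⟩ := Finset.mem_inter.mp hc
      obtain ⟨gl, e1, e2, e3⟩ := ihl c h1
      obtain ⟨gr, k1, k2, k3⟩ := ihr c h2
      refine ⟨.node c gl gr, .node c e1 k1, rfl, ?_⟩
      simp only [ETree.changes, e2, k2, e3, k3, if_true]; omega

lemma pscore_eq (f : ℕ → ℕ) (T : PTree ℕ) : pscore f T = (fitch f T).2 := by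
  have : IsLeast { k : ℕ | ∃ g : ETree ℕ, IsExtension f T g ∧ g.changes = k } (fitch f T).2 := by
    constructor
    · obtain ⟨c, hc⟩ := fitch_nonempty f T
      obtain ⟨g, h1, _, h3⟩ := fitch_upper f T c hc
      exact ⟨g, h1, h3⟩
    · rintro k ⟨g, hg, rfl⟩
      have := fitch_lower f T g hg
      omega
  exact this.csInf_eq

lemma fitch_shift (f : ℕ → ℕ) (s : ℕ) (T : PTree ℕ) :
    fitch f (shiftT s T) = fitch (fun x => f (x + s)) T := by
  unfold shiftT
  induction T with
  | leaf x => rfl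
  | node l r ihl ihr => simp only [PTree.map, fitch, ihl, ihr]

lemma fitch_inj (f φ : ℕ → ℕ) (hφ : Function.Injective φ) (T : PTree ℕ) :
    fitch (fun x => φ (f x)) T = ((fitch f T).1.image φ, (fitch f T).2) := by
  induction T with
  | leaf x => simp [fitch]
  | node l r ihl ihr =>
    simp only [fitch, ihl, ihr, ← Finset.image_inter _ _ hφ, Finset.image_eq_empty,
      ← Finset.image_union]
    split_ifs <;> rfl

lemma fitch_congr (f g : ℕ → ℕ) (T : PTree ℕ) (h : ∀ x ∈ T.leaves, f x = g x) :
    fitch f T = fitch g T := by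
  induction T with
  | leaf x => simp [fitch, h x (by simp [PTree.leaves])]
  | node l r ihl ihr =>
    simp only [fitch, ihl (fun x hx => h x (by simp [PTree.leaves, hx])),
      ihr (fun x hx => h x (by simp [PTree.leaves, hx]))]

/-- The key relation between the Fitch data of the two six-taxon trees. -/
def Good (a b : Finset ℕ × ℕ) : Prop :=
  b.2 ≤ a.2 + 2 ∧ (b.2 = a.2 + 2 → a.1 ⊆ b.1) ∧ a.2 ≤ b.2 + 1 ∧ (a.2 = b.2 + 1 → b.1 ⊆ a.1)

instance (a b : Finset ℕ × ℕ) : Decidable (Good a b) := by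
  unfold Good; infer_instance

def vec (a b c d e : ℕ) : ℕ → ℕ
  | 1 => a | 2 => b | 3 => c | 4 => d | 5 => e | _ => 0

set_option maxRecDepth 100000 in
lemma good_fin : ∀ a < 2, ∀ b < 3, ∀ c < 4, ∀ d < 5, ∀ e < 6,
    Good (fitch (vec a b c d e) Ta6) (fitch (vec a b c d e) Tb6) := by
  decide +kernel

lemma good (f : ℕ → ℕ) : Good (fitch f Ta6) (fitch f Tb6) := by
  let φ : ℕ → ℕ := fun c =>
    if c = f 0 then 0 else if c = f 1 then 1 else if c = f 2 then 2 else
    if c = f 3 then 3 else if c = f 4 then 4 else if c = f 5 then 5 else c + 6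
  have hφ : Function.Injective φ := by
    intro x y hxy
    simp only [φ] at hxy
    split_ifs at hxy <;> omega
  have key := good_fin (φ (f 1)) (by simp only [φ]; split_ifs <;> omega)
    (φ (f 2)) (by simp only [φ]; split_ifs <;> omega)
    (φ (f 3)) (by simp only [φ]; split_ifs <;> omega)
    (φ (f 4)) (by simp only [φ]; split_ifs <;> omega)
    (φ (f 5)) (by simp only [φ]; split_ifs <;> omega)
  have h0 : φ (f 0) = 0 := by simp [φ]
  have hA := fitch_congr (fun x => φ (f x))
    (vec (φ (f 1)) (φ (f 2)) (φ (f 3)) (φ (f 4)) (φ (f 5))) Ta6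
    (by simp [Ta6, PTree.leaves, vec, h0])
  have hB := fitch_congr (fun x => φ (f x))
    (vec (φ (f 1)) (φ (f 2)) (φ (f 3)) (φ (f 4)) (φ (f 5))) Tb6
    (by simp [Tb6, PTree.leaves, vec, h0])
  rw [← hA, ← hB, fitch_inj f φ hφ, fitch_inj f φ hφ] at key
  simpa only [Good, Finset.image_subset_image_iff hφ] using key

lemma bounds (f : ℕ → ℕ) : pscore f TB12 ≤ pscore f TA12 + 4 ∧
    pscore f TA12 ≤ pscore f TB12 + 2 := by
  rw [pscore_eq, pscore_eq]
  have h1 := good f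
  have h2 := good (fun x => f (x + 6))
  simp only [TA12, TB12, fitch, fitch_shift]
  generalize fitch f Ta6 = a at *
  generalize fitch f Tb6 = b at *
  generalize fitch (fun x => f (x + 6)) Ta6 = a' at *
  generalize fitch (fun x => f (x + 6)) Tb6 = b' at *
  obtain ⟨p1, p2, p3, p4⟩ := h1
  obtain ⟨q1, q2, q3, q4⟩ := h2
  have e1 : b.2 = a.2 + 2 → b'.2 = a'.2 + 2 → b.1 ∩ b'.1 = ∅ → a.1 ∩ a'.1 = ∅ := by
    intro x y z
    exact Finset.subset_empty.mp (z ▸ Finset.inter_subset_inter (p2 x) (q2 y))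
  have e2 : a.2 = b.2 + 1 → a'.2 = b'.2 + 1 → a.1 ∩ a'.1 = ∅ → b.1 ∩ b'.1 = ∅ := by
    intro x y z
    exact Finset.subset_empty.mp (z ▸ Finset.inter_subset_inter (p4 x) (q4 y))
  clear p2 p4 q2 q4
  by_cases u : a.1 ∩ a'.1 = ∅ <;> by_cases v : b.1 ∩ b'.1 = ∅ <;>
    simp only [u, v, if_true, if_false] at * <;> constructor <;> grind

lemma max_BA : maxDiff TA12 TB12 = 4 := by
  refine IsGreatest.csSup_eq ⟨⟨fun x => vec 1 1 2 2 0 (x % 6), ?_⟩, ?_⟩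
  · rw [pscore_eq, pscore_eq]; decide +kernel
  · rintro d ⟨f, rfl⟩
    have := bounds f
    omega

lemma max_AB : maxDiff TB12 TA12 = 2 := by
  refine IsGreatest.csSup_eq ⟨⟨fun x => vec 0 1 1 0 0 (x % 6), ?_⟩, ?_⟩
  · rw [pscore_eq, pscore_eq]; decide +kernel
  · rintro d ⟨f, rfl⟩
    have := bounds f
    omega

/-- for the 12-taxon trees `T_A` and `T_B`:
`max_f (l_f(T_B) − l_f(T_A)) = 4`, `max_f (l_f(T_A) − l_f(T_B)) = 2`, hence
`gap(T_A,T_B) = 2`. -/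
theorem TA12_TB12_gap :
    maxDiff TA12 TB12 = 4 ∧
    maxDiff TB12 TA12 = 2 ∧
    gap TA12 TB12 = 2 := by
  refine ⟨max_BA, max_AB, ?_⟩
  rw [gap, max_BA, max_AB]; norm_num

end MPDist
end

section
/- For every integer k ≥ 2, d_MP(T^k_A, T^k_B) = 4k. -/
namespace MPDist

/-- Every extension on `T` gives one on `T'` with the same root state and at most `n` more changes. -/
def Dom (n : ℕ) (T T' : PTree ℕ) : Prop :=
  ∀ (f : ℕ → ℕ) (g : ETree ℕ), IsExtension f T g →
    ∃ g', IsExtension f T' g' ∧ g'.root = g.root ∧ g'.changes ≤ g.changes + n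

theorem Dom.node' {n m : ℕ} {l l' r r' : PTree ℕ} (h1 : Dom n l l') (h2 : Dom m r r') :
    Dom (n + m) (.node l r) (.node l' r') := by
  intro f g hg
  cases hg with
  | node c hl hr =>
    obtain ⟨gl, a1, a2, a3⟩ := h1 f _ hl
    obtain ⟨gr, b1, b2, b3⟩ := h2 f _ hr
    refine ⟨.node c gl gr, .node c a1 b1, rfl, ?_⟩
    simp only [ETree.changes, a2, b2]
    omega

/-- indicator -/
def ne01 (a b : ℕ) : ℕ := if a = b then 0 else 1

theorem tri (a b c : ℕ) : ne01 a c ≤ ne01 a b + ne01 b c := by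
  unfold ne01; split_ifs <;> omega

theorem ne01_comm (a b : ℕ) : ne01 a b = ne01 b a := by
  unfold ne01; split_ifs <;> omega

theorem ne01_le (a b : ℕ) : ne01 a b ≤ 1 := by
  unfold ne01; split_ifs <;> omega

theorem ne01_self (a : ℕ) : ne01 a a = 0 := by simp [ne01]

theorem changes_node (c : ℕ) (l r : ETree ℕ) : (ETree.node c l r).changes =
    ne01 l.root c + ne01 r.root c + (l.changes + r.changes) := rfl

theorem changes_leaf (c : ℕ) : (ETree.leaf c).changes = 0 := rfl
theorem root_leaf (c : ℕ) : (ETree.leaf c).root = c := rfl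
theorem root_node (c : ℕ) (l r : ETree ℕ) : (ETree.node c l r).root = c := rfl

theorem domAB (φ : ℕ → ℕ) : Dom 2 (Ta6.map φ) (Tb6.map φ) := by
  intro f g hg
  simp only [Ta6, PTree.map] at hg
  rcases hg with _ | ⟨s, hg, h0⟩
  rcases hg with _ | ⟨u4, hg, h5⟩
  rcases hg with _ | ⟨u3, hg, h4⟩
  rcases hg with _ | ⟨u2, hg, h3⟩
  rcases hg with _ | ⟨u1, h1, h2⟩
  cases h0; cases h1; cases h2; cases h3; cases h4; cases h5
  refine ⟨.node s (.node u3 (.node u2 (.node (f (φ 1)) (.leaf (f (φ 1))) (.leaf (f (φ 5))))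
    (.node u2 (.leaf (f (φ 2))) (.leaf (f (φ 3))))) (.leaf (f (φ 4)))) (.leaf (f (φ 0))), ?_, rfl, ?_⟩
  · exact .node _ (.node _ (.node _ (.node _ (.leaf _) (.leaf _)) (.node _ (.leaf _) (.leaf _)))
      (.leaf _)) (.leaf _)
  · simp only [changes_node, changes_leaf, root_node, root_leaf, ne01_self]
    generalize f (φ 0) = x0
    generalize f (φ 1) = x1
    generalize f (φ 2) = x2
    generalize f (φ 3) = x3
    generalize f (φ 4) = x4
    generalize f (φ 5) = x5
    have := tri u3 u4 s
    have := ne01_le x5 x1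
    have := tri x1 u1 u2
    have := tri x2 u1 u2
    have := ne01_le u1 u2
    omega

theorem domBA (φ : ℕ → ℕ) : Dom 2 (Tb6.map φ) (Ta6.map φ) := by
  intro f g hg
  simp only [Tb6, PTree.map] at hg
  rcases hg with _ | ⟨s, hg, h0⟩
  rcases hg with _ | ⟨v4, hg, h4⟩
  rcases hg with _ | ⟨v3, hg, hg'⟩
  rcases hg with _ | ⟨v1, h1, h5⟩
  rcases hg' with _ | ⟨v2, h2, h3⟩
  cases h0; cases h1; cases h2; cases h3; cases h4; cases h5
  refine ⟨.node s (.node v4 (.node v4 (.node v3 (.node v3 (.leaf (f (φ 1))) (.leaf (f (φ 2))))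
    (.leaf (f (φ 3)))) (.leaf (f (φ 4)))) (.leaf (f (φ 5)))) (.leaf (f (φ 0))), ?_, rfl, ?_⟩
  · exact .node _ (.node _ (.node _ (.node _ (.node _ (.leaf _) (.leaf _)) (.leaf _)) (.leaf _))
      (.leaf _)) (.leaf _)
  · simp only [changes_node, changes_leaf, root_node, root_leaf, ne01_self]
    generalize f (φ 0) = x0
    generalize f (φ 1) = x1
    generalize f (φ 2) = x2
    generalize f (φ 3) = x3
    generalize f (φ 4) = x4
    generalize f (φ 5) = x5
    have := ne01_le x5 v4
    have := tri x1 v1 v3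
    have := tri x2 v2 v3
    have := tri x3 v2 v3
    have := ne01_le v2 v3
    omega

theorem map_id' (T : PTree ℕ) : T.map (fun x => x) = T := by
  induction T with
  | leaf x => rfl
  | node l r hl hr => simp only [PTree.map, hl, hr]

theorem TkA_zero : TkA 0 = .node (Ta6.map (fun x => x)) (Ta6.map (fun x => x + 6)) := rfl
theorem TkB_zero : TkB 0 = .node (Tb6.map (fun x => x)) (Tb6.map (fun x => x + 6)) := rfl
theorem TkA_succ (k : ℕ) : TkA (k + 1) = .node (TkA k)
    (.node (Ta6.map (fun x => x + 12 * (k + 1))) (Ta6.map (fun x => x + 6 + 12 * (k + 1)))) := rfl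
theorem TkB_succ (k : ℕ) : TkB (k + 1) = .node (TkB k)
    (.node (Tb6.map (fun x => x + 12 * (k + 1))) (Tb6.map (fun x => x + 6 + 12 * (k + 1)))) := rfl

theorem domTAB (k : ℕ) : Dom (4 * (k + 1)) (TkA k) (TkB k) := by
  induction k with
  | zero => rw [TkA_zero, TkB_zero]; exact (domAB _).node' (domAB _)
  | succ k ih => rw [TkA_succ, TkB_succ]; exact ih.node' ((domAB _).node' (domAB _))

theorem domTBA (k : ℕ) : Dom (4 * (k + 1)) (TkB k) (TkA k) := by
  induction k with
  | zero => rw [TkA_zero, TkB_zero]; exact (domBA _).node' (domBA _)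
  | succ k ih => rw [TkA_succ, TkB_succ]; exact ih.node' ((domBA _).node' (domBA _))

theorem exists_ext (f : ℕ → ℕ) (T : PTree ℕ) : ∃ g, IsExtension f T g := by
  induction T with
  | leaf x => exact ⟨_, .leaf x⟩
  | node l r hl hr =>
    obtain ⟨gl, hl⟩ := hl
    obtain ⟨gr, hr⟩ := hr
    exact ⟨_, .node 0 hl hr⟩

theorem pscore_mem (f : ℕ → ℕ) (T : PTree ℕ) :
    ∃ g : ETree ℕ, IsExtension f T g ∧ g.changes = pscore f T := by
  obtain ⟨g, hg⟩ := exists_ext f T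
  exact Nat.sInf_mem (s := { k : ℕ | ∃ g : ETree ℕ, IsExtension f T g ∧ g.changes = k })
    ⟨_, g, hg, rfl⟩

theorem pscore_le (f : ℕ → ℕ) (T : PTree ℕ) (g : ETree ℕ) (hg : IsExtension f T g) :
    pscore f T ≤ g.changes := Nat.sInf_le ⟨g, hg, rfl⟩

theorem Dom.pscore {n : ℕ} {T T' : PTree ℕ} (h : Dom n T T') (f : ℕ → ℕ) :
    pscore f T' ≤ pscore f T + n := by
  obtain ⟨g, hg, e⟩ := pscore_mem f T
  obtain ⟨g', hg', -, hle⟩ := h f g hg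
  have := pscore_le f T' g' hg'
  omega

/-- the extremal character on one block -/
def chi0 : ℕ → ℕ
  | 0 => 0
  | 1 => 1
  | 2 => 1
  | 3 => 2
  | 4 => 2
  | _ => 0

/-- the extremal character -/
def chi (x : ℕ) : ℕ := chi0 (x % 6)

theorem blockA (φ : ℕ → ℕ) (hφ : ∀ x, φ x % 6 = x % 6) :
    ∃ g, IsExtension chi (Ta6.map φ) g ∧ g.root = 0 ∧ g.changes = 2 := by
  refine ⟨.node 0 (.node 0 (.node 2 (.node 2 (.node 1 (.leaf (chi (φ 1))) (.leaf (chi (φ 2))))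
    (.leaf (chi (φ 3)))) (.leaf (chi (φ 4)))) (.leaf (chi (φ 5)))) (.leaf (chi (φ 0))),
    ?_, rfl, ?_⟩
  · exact .node _ (.node _ (.node _ (.node _ (.node _ (.leaf _) (.leaf _)) (.leaf _)) (.leaf _))
      (.leaf _)) (.leaf _)
  · simp [ETree.changes, ETree.root, chi, hφ, chi0]

theorem blockB (φ : ℕ → ℕ) (hφ : ∀ x, φ x % 6 = x % 6) (g : ETree ℕ)
    (hg : IsExtension chi (Tb6.map φ) g) : 4 ≤ g.changes := by
  simp only [Tb6, PTree.map] at hg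
  rcases hg with _ | ⟨s, hg, h0⟩
  rcases hg with _ | ⟨v4, hg, h4⟩
  rcases hg with _ | ⟨v3, hg, hg'⟩
  rcases hg with _ | ⟨v1, h1, h5⟩
  rcases hg' with _ | ⟨v2, h2, h3⟩
  cases h0; cases h1; cases h2; cases h3; cases h4; cases h5
  simp only [ETree.changes, ETree.root, chi, hφ, chi0, Nat.reduceMod]
  grind

theorem totalA (k : ℕ) :
    ∃ g, IsExtension chi (TkA k) g ∧ g.root = 0 ∧ g.changes = 4 * (k + 1) := by
  induction k with
  | zero =>
    obtain ⟨g1, a1, a2, a3⟩ := blockA (fun x => x) (fun x => rfl)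
    obtain ⟨g2, b1, b2, b3⟩ := blockA (fun x => x + 6) (fun x => by simp)
    refine ⟨.node 0 g1 g2, ?_, rfl, ?_⟩
    · rw [TkA_zero]; exact .node _ a1 b1
    · simp [ETree.changes, a2, a3, b2, b3]
  | succ k ih =>
    obtain ⟨g0, c1, c2, c3⟩ := ih
    obtain ⟨g1, a1, a2, a3⟩ := blockA (fun x => x + 12 * (k + 1)) (fun x => by omega)
    obtain ⟨g2, b1, b2, b3⟩ := blockA (fun x => x + 6 + 12 * (k + 1))
      (fun x => by omega)
    refine ⟨.node 0 g0 (.node 0 g1 g2), ?_, rfl, ?_⟩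
    · rw [TkA_succ]; exact .node _ c1 (.node _ a1 b1)
    · simp [ETree.changes, root_node, a2, a3, b2, b3, c2, c3]; omega

theorem totalB (k : ℕ) (g : ETree ℕ) (hg : IsExtension chi (TkB k) g) :
    8 * (k + 1) ≤ g.changes := by
  induction k generalizing g with
  | zero =>
    rw [TkB_zero] at hg
    rcases hg with _ | ⟨s, h1, h2⟩
    have := blockB _ (fun x => rfl) _ h1
    have := blockB _ (fun x => by simp) _ h2
    simp only [ETree.changes]; omega
  | succ k ih =>
    rw [TkB_succ] at hg
    rcases hg with _ | ⟨s, h0, hg⟩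
    rcases hg with _ | ⟨s', h1, h2⟩
    have := ih _ h0
    have := blockB _ (fun x => by omega) _ h1
    have := blockB _ (fun x => by omega) _ h2
    simp only [ETree.changes]; omega

/-- for every `k ≥ 2`, `d_MP(T^k_A, T^k_B) = 4k`.
(Recall `TkA (k-1) = T^k_A`.) -/
theorem dMP_TkA_TkB (k : ℕ) (hk : 2 ≤ k) :
    dMP (TkA (k - 1)) (TkB (k - 1)) = 4 * k := by
  obtain ⟨k, rfl⟩ : ∃ j, k = j + 1 := ⟨k - 1, by omega⟩
  simp only [Nat.add_sub_cancel]
  have ub : ∀ f : ℕ → ℕ,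
      ((pscore f (TkA k) : ℤ) - (pscore f (TkB k) : ℤ)).natAbs ≤ 4 * (k + 1) := by
    intro f
    have := (domTAB k).pscore f
    have := (domTBA k).pscore f
    omega
  apply IsGreatest.csSup_eq
  refine ⟨⟨chi, ?_⟩, ?_⟩
  · apply le_antisymm _ (ub chi)
    obtain ⟨g, a1, -, a3⟩ := totalA k
    have := pscore_le _ _ _ a1
    obtain ⟨g', b1, b2⟩ := pscore_mem chi (TkB k)
    have := totalB k _ b1
    omega
  · rintro _ ⟨f, rfl⟩
    exact ub f

end MPDist
end
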